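/- arXiv:0903.2574 — 2 statements merged into one kernel-verified Lean document; each statement's English description precedes it below -/
import Mathlib

section
/- Let x,y ∈ {-1,1}^n be random with (x_i,y_i) independent across i, each x_i and y_i uniform on {-1,1}, and |E[x_i y_i]| ≤ ρ for all i, where 0 ≤ ρ < 1. If B1, B2 ⊆ {-1,1}^n satisfy P[x ∈ B1] ≥ e^{-α²} and P[y ∈ B2] ≥ e^{-β²}, then P[x ∈ B1, y ∈ B2] ≥ exp(-(α² + β² + 2ραβ)/(1-ρ²)). -/
/-- The ±1 value of a bit. -/
noncomputable def sgn (b : Bool) : ℝ := if b then 1 else -1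

open Finset

/-- Concavity of `tanh`, written in the variable `ε = tanh u`. -/
theorem mul_rpow_add_rpow_le_rpow_sub_rpow {s ε : ℝ} (hs0 : 0 ≤ s) (hs1 : s ≤ 1)
    (hε0 : 0 ≤ ε) (hε1 : ε < 1) :
    s * ε * ((1 + ε) ^ s + (1 - ε) ^ s) ≤ (1 + ε) ^ s - (1 - ε) ^ s := by
  have hsε0 : 0 ≤ s * ε := mul_nonneg hs0 hε0
  have hsε1 : s * ε < 1 := by nlinarith
  have h1 := Real.hasSum_log_sub_log_of_abs_lt_one (x := ε) (by rw [abs_of_nonneg hε0]; exact hε1)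
  have h2 := Real.hasSum_log_sub_log_of_abs_lt_one (x := s * ε)
    (by rw [abs_of_nonneg hsε0]; exact hsε1)
  have key : Real.log (1 + s * ε) - Real.log (1 - s * ε)
      ≤ s * (Real.log (1 + ε) - Real.log (1 - ε)) := by
    refine hasSum_le (fun k => ?_) h2 (h1.mul_left s)
    have hpow : s ^ (2 * k + 1) ≤ s := by
      simpa using pow_le_pow_of_le_one hs0 hs1 (show 1 ≤ 2 * k + 1 by omega)
    have hc : 0 ≤ 2 * (1 / (2 * (k : ℝ) + 1)) * ε ^ (2 * k + 1) := by positivity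
    rw [mul_pow]
    nlinarith [mul_le_mul_of_nonneg_right hpow hc]
  have hp1 : 0 < 1 + ε := by linarith
  have hm1 : 0 < 1 - ε := by linarith
  have hp2 : 0 < 1 + s * ε := by linarith
  have hm2 : 0 < 1 - s * ε := by linarith
  have hfin : (1 + s * ε) * (1 - ε) ^ s ≤ (1 + ε) ^ s * (1 - s * ε) := by
    have hA := Real.rpow_pos_of_pos hp1 s
    have hB := Real.rpow_pos_of_pos hm1 s
    rw [← Real.log_le_log_iff (by positivity) (by positivity),
      Real.log_mul hp2.ne' hB.ne', Real.log_mul hA.ne' hm2.ne', Real.log_rpow hp1,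
      Real.log_rpow hm1]
    linarith
  linarith

/-- The two-point inequality between the `p`-mean and the geometric mean of the noised function,
normalised to mean one. -/
theorem log_rpow_add_rpow_le_log_one_sub_mul_sq {p ε : ℝ} (hp0 : 0 < p) (hp1 : p ≤ 1)
    (hε0 : 0 ≤ ε) (hε1 : ε ≤ 1) :
    Real.log (((1 + ε) ^ p + (1 - ε) ^ p) / 2) ≤ p / 2 * Real.log (1 - (1 - p) * ε ^ 2) := by
  let φ : ℝ → ℝ := fun e =>
    p / 2 * Real.log (1 - (1 - p) * e ^ 2) - Real.log (((1 + e) ^ p + (1 - e) ^ p) / 2)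
  have hpos1 : ∀ e ∈ Set.Icc (0 : ℝ) 1, 0 < 1 - (1 - p) * e ^ 2 := by
    rintro e ⟨h0, h1⟩
    nlinarith [mul_nonneg (sub_nonneg.2 hp1) (sub_nonneg.2 (pow_le_one₀ (n := 2) h0 h1))]
  have hpos2 : ∀ e ∈ Set.Icc (0 : ℝ) 1, 0 < ((1 + e) ^ p + (1 - e) ^ p) / 2 := by
    rintro e ⟨h0, h1⟩
    have := Real.rpow_pos_of_pos (show 0 < 1 + e by linarith) p
    have := Real.rpow_nonneg (show 0 ≤ 1 - e by linarith) p
    linarith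
  have hmono : MonotoneOn φ (Set.Icc 0 1) := by
    have hderiv : ∀ e ∈ Set.Ioo (0 : ℝ) 1, HasDerivAt φ
        (p / 2 * (-((1 - p) * (2 * e)) / (1 - (1 - p) * e ^ 2))
          - ((p * (1 + e) ^ (p - 1) - p * (1 - e) ^ (p - 1)) / 2)
            / (((1 + e) ^ p + (1 - e) ^ p) / 2)) e := by
      intro e he
      have he' := Set.Ioo_subset_Icc_self he
      have hu : HasDerivAt (fun e : ℝ => 1 - (1 - p) * e ^ 2) (-((1 - p) * (2 * e))) e := by
        simpa using ((hasDerivAt_pow 2 e).const_mul (1 - p)).const_sub 1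
      have ha : HasDerivAt (fun e : ℝ => (1 + e) ^ p) (p * (1 + e) ^ (p - 1)) e := by
        simpa using ((hasDerivAt_id e).const_add 1).rpow_const (p := p)
          (Or.inl (by simpa using (by linarith [he.1] : (0 : ℝ) < 1 + e).ne'))
      have hb : HasDerivAt (fun e : ℝ => (1 - e) ^ p) (-(p * (1 - e) ^ (p - 1))) e := by
        simpa using ((hasDerivAt_id e).const_sub 1).rpow_const (p := p)
          (Or.inl (by simpa using (by linarith [he.2] : (0 : ℝ) < 1 - e).ne'))
      have hv : HasDerivAt (fun e : ℝ => ((1 + e) ^ p + (1 - e) ^ p) / 2)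
          ((p * (1 + e) ^ (p - 1) - p * (1 - e) ^ (p - 1)) / 2) e := by
        simpa [sub_eq_add_neg] using (ha.add hb).div_const 2
      exact ((hu.log (hpos1 e he').ne').const_mul (p / 2)).sub (hv.log (hpos2 e he').ne')
    refine monotoneOn_of_deriv_nonneg (convex_Icc 0 1) ?_ ?_ ?_
    · refine ContinuousOn.sub (continuousOn_const.mul (ContinuousOn.log ?_ ?_))
        (ContinuousOn.log ?_ ?_)
      · fun_prop
      · exact fun e he => (hpos1 e he).ne'
      · refine ContinuousOn.div_const (ContinuousOn.add ?_ ?_) 2 <;>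
          exact ContinuousOn.rpow_const (by fun_prop) fun _ _ => Or.inr hp0.le
      · exact fun e he => (hpos2 e he).ne'
    · rw [interior_Icc]
      exact fun e he => (hderiv e he).differentiableAt.differentiableWithinAt
    · rw [interior_Icc]
      intro e he
      rw [(hderiv e he).deriv]
      have he' := Set.Ioo_subset_Icc_self he
      have hP : 0 < 1 + e := by linarith [he.1]
      have hM : 0 < 1 - e := by linarith [he.2]
      have hst := mul_rpow_add_rpow_le_rpow_sub_rpow (s := 1 - p) (by linarith) (by linarith)
        he.1.le he.2
      have h1 := hpos1 e he'
      have h2 := hpos2 e he'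
      have hPp : (1 + e) ^ p = (1 + e) * (1 + e) ^ (p - 1) := by
        rw [Real.rpow_sub_one hP.ne']; field_simp
      have hMp : (1 - e) ^ p = (1 - e) * (1 - e) ^ (p - 1) := by
        rw [Real.rpow_sub_one hM.ne']; field_simp
      have hPs : (1 + e) ^ (1 - p) * (1 + e) ^ (p - 1) = 1 := by
        rw [← Real.rpow_add hP]; simp
      have hMs : (1 - e) ^ (1 - p) * (1 - e) ^ (p - 1) = 1 := by
        rw [← Real.rpow_add hM]; simp
      have hA := Real.rpow_pos_of_pos hP (p - 1)
      have hB := Real.rpow_pos_of_pos hM (p - 1)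
      rw [hPp, hMp] at h2 ⊢
      generalize (1 + e) ^ (p - 1) = A at *
      generalize (1 - e) ^ (p - 1) = B at *
      generalize (1 + e) ^ (1 - p) = A' at *
      generalize (1 - e) ^ (1 - p) = B' at *
      have hAB : (1 - p) * e * (A + B) ≤ B - A := by
        have := mul_le_mul_of_nonneg_right hst (mul_pos hA hB).le
        have e1 : (1 - p) * e * (A' + B') * (A * B)
            = (1 - p) * e * ((A' * A) * B + (B' * B) * A) := by ring
        have e2 : (A' - B') * (A * B) = (A' * A) * B - (B' * B) * A := by ring
        rw [e1, e2, hPs, hMs] at this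
        linarith
      have heq : p / 2 * (-((1 - p) * (2 * e)) / (1 - (1 - p) * e ^ 2))
          - ((p * A - p * B) / 2) / (((1 + e) * A + (1 - e) * B) / 2)
          = p * (B - A - (1 - p) * e * (A + B)) /
            ((1 - (1 - p) * e ^ 2) * ((1 + e) * A + (1 - e) * B)) := by
        have h3 : (1 + e) * A + (1 - e) * B ≠ 0 := by linarith
        have h1' := h1.ne'
        rw [div_div_div_cancel_right₀ two_ne_zero, mul_div_assoc', div_sub_div _ _ h1' h3]
        congr 1
        ring
      rw [heq]
      exact div_nonneg (mul_nonneg hp0.le (by linarith)) (mul_nonneg h1.le (by linarith))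
  have := hmono (Set.left_mem_Icc.2 zero_le_one) ⟨hε0, hε1⟩ hε0
  simp only [φ] at this
  norm_num at this
  linarith

/-- The `p`-mean of two nonnegative numbers is at most the geometric mean of their images under
the noise operator with parameter `√(1 - p)`. -/
theorem pMean_sq_le {p a b : ℝ} (hp0 : 0 < p) (hp1 : p ≤ 1) (ha : 0 ≤ a) (hb : 0 ≤ b) :
    (((a ^ p + b ^ p) / 2) ^ (1 / p)) ^ 2 ≤ ((a + b) / 2) ^ 2 - (1 - p) * ((a - b) / 2) ^ 2 := by
  wlog hab : b ≤ a generalizing a b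
  · have := this hb ha (le_of_not_ge hab)
    rw [add_comm (b ^ p), add_comm b] at this
    linarith [show ((b - a) / 2) ^ 2 = ((a - b) / 2) ^ 2 by ring]
  rcases ha.eq_or_lt with rfl | ha'
  · obtain rfl : b = 0 := le_antisymm hab hb
    simp [Real.zero_rpow hp0.ne', Real.zero_rpow (inv_ne_zero hp0.ne')]
  set m := (a + b) / 2 with hm
  have hm0 : 0 < m := by rw [hm]; linarith
  set ε := (a - b) / (a + b) with hε
  have hε0 : 0 ≤ ε := div_nonneg (by linarith) (by linarith)
  have hε1 : ε ≤ 1 := by rw [hε, div_le_one (by linarith)]; linarith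
  have hs : a + b ≠ 0 := by linarith
  have haε : a = m * (1 + ε) := by rw [hm, hε]; field_simp; ring
  have hbε : b = m * (1 - ε) := by rw [hm, hε]; field_simp; ring
  have hdε : (a - b) / 2 = m * ε := by rw [hm, hε]; field_simp
  have hlog := log_rpow_add_rpow_le_log_one_sub_mul_sq hp0 hp1 hε0 hε1
  have hV : 0 < ((1 + ε) ^ p + (1 - ε) ^ p) / 2 := by
    have := Real.rpow_pos_of_pos (show 0 < 1 + ε by linarith) p
    have := Real.rpow_nonneg (show 0 ≤ 1 - ε by linarith) p
    linarith
  have hU : 0 < 1 - (1 - p) * ε ^ 2 := by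
    nlinarith [mul_nonneg (sub_nonneg.2 hp1) (sub_nonneg.2 (pow_le_one₀ (n := 2) hε0 hε1))]
  have hmean : (a ^ p + b ^ p) / 2 = m ^ p * (((1 + ε) ^ p + (1 - ε) ^ p) / 2) := by
    rw [haε, hbε, Real.mul_rpow hm0.le (by linarith), Real.mul_rpow hm0.le (by linarith)]
    ring
  have hroot : ((a ^ p + b ^ p) / 2) ^ (1 / p)
      = m * (((1 + ε) ^ p + (1 - ε) ^ p) / 2) ^ (1 / p) := by
    rw [hmean, Real.mul_rpow (Real.rpow_nonneg hm0.le _) hV.le, ← Real.rpow_mul hm0.le,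
      mul_one_div_cancel hp0.ne', Real.rpow_one]
  have hsq : ((((1 + ε) ^ p + (1 - ε) ^ p) / 2) ^ (1 / p)) ^ 2 ≤ 1 - (1 - p) * ε ^ 2 := by
    have hW := Real.rpow_pos_of_pos hV (1 / p)
    rw [← Real.log_le_log_iff (by positivity) hU, Real.log_pow, Real.log_rpow hV]
    calc ((2 : ℕ) : ℝ) * (1 / p * Real.log (((1 + ε) ^ p + (1 - ε) ^ p) / 2))
        = 2 / p * Real.log (((1 + ε) ^ p + (1 - ε) ^ p) / 2) := by push_cast; ring
      _ ≤ 2 / p * (p / 2 * Real.log (1 - (1 - p) * ε ^ 2)) := by gcongr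
      _ = Real.log (1 - (1 - p) * ε ^ 2) := by field_simp
  rw [hroot, hdε, mul_pow]
  calc m ^ 2 * _ ≤ m ^ 2 * (1 - (1 - p) * ε ^ 2) := by gcongr
    _ = m ^ 2 - (1 - p) * (m * ε) ^ 2 := by ring

/-- Two-function reverse hypercontractivity for a single pair of correlated bits. -/
theorem two_point_reverse_hypercontractive {p q ρ : ℝ} (hp0 : 0 < p) (hp1 : p ≤ 1)
    (hq0 : 0 < q) (hq1 : q ≤ 1) (hρ0 : 0 ≤ ρ) (hpq : (1 - p) * (1 - q) = ρ ^ 2)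
    {μ : Bool × Bool → ℝ}
    (hmargx : ∀ b, μ (b, true) + μ (b, false) = 1/2)
    (hmargy : ∀ b, μ (true, b) + μ (false, b) = 1/2)
    (hcor : |∑ z : Bool × Bool, μ z * (sgn z.1 * sgn z.2)| ≤ ρ)
    {F G : Bool → ℝ} (hF : ∀ b, 0 ≤ F b) (hG : ∀ b, 0 ≤ G b) :
    ((F true ^ p + F false ^ p) / 2) ^ (1 / p) * ((G true ^ q + G false ^ q) / 2) ^ (1 / q) ≤
      ∑ b, ∑ c, μ (b, c) * (F b * G c) := by
  have hf := pMean_sq_le hp0 hp1 (hF true) (hF false)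
  have hg := pMean_sq_le hq0 hq1 (hG true) (hG false)
  set X := (F true + F false) / 2 with hX
  set x := (F true - F false) / 2 with hx
  set Y := (G true + G false) / 2 with hY
  set y := (G true - G false) / 2 with hy
  set c := ∑ z : Bool × Bool, μ z * (sgn z.1 * sgn z.2) with hc
  have hX0 : |x| ≤ X := by
    rw [abs_le]; constructor <;> linarith [hF true, hF false]
  have hY0 : |y| ≤ Y := by
    rw [abs_le]; constructor <;> linarith [hG true, hG false]
  have hρ1 : ρ ≤ 1 := by nlinarith
  have hsum : ∑ b, ∑ c, μ (b, c) * (F b * G c) = X * Y + c * (x * y) := by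
    have h1 := hmargx true
    have h2 := hmargx false
    have h3 := hmargy true
    have e1 : μ (true, false) = 1 / 2 - μ (true, true) := by linarith
    have e2 : μ (false, true) = 1 / 2 - μ (true, true) := by linarith
    have e3 : μ (false, false) = μ (true, true) := by linarith
    rw [hc, Fintype.sum_prod_type]
    simp only [Fintype.sum_bool, sgn, e1, e2, e3, hX, hx, hY, hy]
    simp
    ring
  have hxy : |x| * |y| ≤ X * Y := mul_le_mul hX0 hY0 (abs_nonneg _) ((abs_nonneg _).trans hX0)
  have hlow : X * Y - ρ * (|x| * |y|) ≤ X * Y + c * (x * y) := by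
    have h1 : |c * (x * y)| ≤ ρ * (|x| * |y|) := by
      rw [abs_mul, abs_mul]; gcongr
    linarith [(abs_le.1 h1).1]
  have hnn : 0 ≤ X * Y - ρ * (|x| * |y|) := by
    nlinarith [mul_nonneg (abs_nonneg x) (abs_nonneg y)]
  rw [hsum]
  refine le_trans (le_of_sq_le_sq ?_ hnn) hlow
  rw [mul_pow]
  have hYsq : 0 ≤ Y ^ 2 - (1 - q) * y ^ 2 := le_trans (sq_nonneg _) hg
  have hXsq : 0 ≤ X ^ 2 - (1 - p) * x ^ 2 := le_trans (sq_nonneg _) hf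
  refine (mul_le_mul hf hg (sq_nonneg _) hXsq).trans ?_
  have hσ := Real.sq_sqrt (sub_nonneg.2 hp1)
  have hτ := Real.sq_sqrt (sub_nonneg.2 hq1)
  have hστ : √(1 - p) * √(1 - q) = ρ := by
    rw [← Real.sqrt_mul (sub_nonneg.2 hp1), hpq, Real.sqrt_sq hρ0]
  rw [← hσ, ← hτ, ← hστ, ← sq_abs x, ← sq_abs y]
  nlinarith [sq_nonneg (√(1 - p) * |x| * Y - √(1 - q) * |y| * X)]

theorem sum_fin_succ_bool {n : ℕ} (f : (Fin (n + 1) → Bool) → ℝ) :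
    ∑ x, f x = ∑ b : Bool, ∑ x : Fin n → Bool, f (Fin.cons b x) := by
  rw [← (Fin.consEquiv fun _ => Bool).sum_comp, Fintype.sum_prod_type]
  rfl

/-- Two-function reverse hypercontractivity on the discrete cube. -/
theorem reverse_hypercontractive {p q ρ : ℝ} (hp0 : 0 < p) (hp1 : p ≤ 1)
    (hq0 : 0 < q) (hq1 : q ≤ 1) (hρ0 : 0 ≤ ρ) (hpq : (1 - p) * (1 - q) = ρ ^ 2)
    (n : ℕ) (μ : Fin n → Bool × Bool → ℝ)
    (hnn : ∀ i z, 0 ≤ μ i z)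
    (hmargx : ∀ i b, μ i (b, true) + μ i (b, false) = 1/2)
    (hmargy : ∀ i b, μ i (true, b) + μ i (false, b) = 1/2)
    (hcor : ∀ i, |∑ z : Bool × Bool, μ i z * (sgn z.1 * sgn z.2)| ≤ ρ)
    (f g : (Fin n → Bool) → ℝ) (hf : ∀ x, 0 ≤ f x) (hg : ∀ y, 0 ≤ g y) :
    ((∑ x, f x ^ p) / 2 ^ n) ^ (1 / p) * ((∑ y, g y ^ q) / 2 ^ n) ^ (1 / q) ≤
      ∑ x, ∑ y, (∏ i, μ i (x i, y i)) * (f x * g y) := by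
  induction n with
  | zero =>
    simp only [Fintype.sum_unique, pow_zero, div_one, univ_eq_empty, prod_empty, one_mul]
    rw [← Real.rpow_mul (hf _), ← Real.rpow_mul (hg _), mul_one_div_cancel hp0.ne',
      mul_one_div_cancel hq0.ne', Real.rpow_one, Real.rpow_one]
  | succ n ih =>
    let F : Bool → ℝ := fun b => ((∑ x : Fin n → Bool, f (Fin.cons b x) ^ p) / 2 ^ n) ^ (1 / p)
    let G : Bool → ℝ := fun b => ((∑ y : Fin n → Bool, g (Fin.cons b y) ^ q) / 2 ^ n) ^ (1 / q)
    have hF' : ∀ b, 0 ≤ (∑ x : Fin n → Bool, f (Fin.cons b x) ^ p) / 2 ^ n := fun b =>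
      div_nonneg (sum_nonneg fun x _ => Real.rpow_nonneg (hf _) _) (by positivity)
    have hG' : ∀ b, 0 ≤ (∑ y : Fin n → Bool, g (Fin.cons b y) ^ q) / 2 ^ n := fun b =>
      div_nonneg (sum_nonneg fun x _ => Real.rpow_nonneg (hg _) _) (by positivity)
    have hFp : ∀ b, F b ^ p = (∑ x : Fin n → Bool, f (Fin.cons b x) ^ p) / 2 ^ n := fun b => by
      rw [← Real.rpow_mul (hF' b), one_div_mul_cancel hp0.ne', Real.rpow_one]
    have hGq : ∀ b, G b ^ q = (∑ y : Fin n → Bool, g (Fin.cons b y) ^ q) / 2 ^ n := fun b => by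
      rw [← Real.rpow_mul (hG' b), one_div_mul_cancel hq0.ne', Real.rpow_one]
    have htwo := two_point_reverse_hypercontractive hp0 hp1 hq0 hq1 hρ0 hpq (hmargx 0) (hmargy 0)
      (hcor 0) (F := F) (G := G) (fun b => Real.rpow_nonneg (hF' b) _)
      (fun b => Real.rpow_nonneg (hG' b) _)
    have hsplit : ∀ A B : ℝ, (A / 2 ^ n + B / 2 ^ n) / 2 = (A + B) / 2 ^ (n + 1) := by
      intro A B; rw [pow_succ]; field_simp
    rw [hFp, hFp, hGq, hGq, hsplit, hsplit] at htwo
    rw [sum_fin_succ_bool (fun x => f x ^ p), sum_fin_succ_bool (fun y => g y ^ q),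
      Fintype.sum_bool, Fintype.sum_bool]
    refine htwo.trans ?_
    rw [sum_fin_succ_bool]
    refine sum_le_sum fun b _ => ?_
    have hrhs : ∑ x : Fin n → Bool, ∑ y : Fin (n + 1) → Bool,
        (∏ i, μ i ((Fin.cons b x : Fin (n + 1) → Bool) i, y i)) * (f (Fin.cons b x) * g y)
        = ∑ c, μ 0 (b, c) * ∑ x : Fin n → Bool, ∑ y : Fin n → Bool,
          (∏ i, μ (Fin.succ i) (x i, y i)) * (f (Fin.cons b x) * g (Fin.cons c y)) := by
      simp_rw [sum_fin_succ_bool, mul_sum]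
      rw [sum_comm]
      refine sum_congr rfl fun c _ => sum_congr rfl fun x _ => sum_congr rfl fun y _ => ?_
      rw [Fin.prod_univ_succ]
      simp only [Fin.cons_zero, Fin.cons_succ]
      ring
    rw [hrhs]
    refine sum_le_sum fun c _ => mul_le_mul_of_nonneg_left ?_ (hnn 0 _)
    exact ih (fun i => μ i.succ) (fun i => hnn _) (fun i => hmargx _) (fun i => hmargy _)
      (fun i => hcor _) (fun x => f (Fin.cons b x)) (fun y => g (Fin.cons c y))
      (fun x => hf _) (fun y => hg _)

/-- Reverse hypercontractivity for sets, with Hölder exponents `p` and `q`. -/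
theorem rpow_mul_rpow_le_sum_prod {p q ρ : ℝ} (hp0 : 0 < p) (hp1 : p ≤ 1)
    (hq0 : 0 < q) (hq1 : q ≤ 1) (hρ0 : 0 ≤ ρ) (hpq : (1 - p) * (1 - q) = ρ ^ 2)
    (n : ℕ) (μ : Fin n → Bool × Bool → ℝ)
    (hnn : ∀ i z, 0 ≤ μ i z)
    (hmargx : ∀ i b, μ i (b, true) + μ i (b, false) = 1/2)
    (hmargy : ∀ i b, μ i (true, b) + μ i (false, b) = 1/2)
    (hcor : ∀ i, |∑ z : Bool × Bool, μ i z * (sgn z.1 * sgn z.2)| ≤ ρ)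
    (B₁ B₂ : Finset (Fin n → Bool)) :
    ((B₁.card : ℝ) / 2 ^ n) ^ (1 / p) * ((B₂.card : ℝ) / 2 ^ n) ^ (1 / q) ≤
      ∑ x ∈ B₁, ∑ y ∈ B₂, ∏ i, μ i (x i, y i) := by
  have h := reverse_hypercontractive hp0 hp1 hq0 hq1 hρ0 hpq n μ hnn hmargx hmargy hcor
    (fun x => if x ∈ B₁ then 1 else 0) (fun y => if y ∈ B₂ then 1 else 0)
    (fun x => by positivity) (fun y => by positivity)
  have hsum : ∑ x, ∑ y, (∏ i, μ i (x i, y i)) *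
      ((if x ∈ B₁ then (1 : ℝ) else 0) * (if y ∈ B₂ then 1 else 0))
      = ∑ x ∈ B₁, ∑ y ∈ B₂, ∏ i, μ i (x i, y i) := by
    rw [← sum_subset (subset_univ B₁) fun x _ hx => by simp [hx]]
    refine sum_congr rfl fun x hx => ?_
    simp [hx]
  rw [hsum] at h
  simpa [apply_ite (fun t : ℝ => t ^ p), apply_ite (fun t : ℝ => t ^ q),
    Real.zero_rpow hp0.ne', Real.zero_rpow hq0.ne'] using h

theorem exp_neg_div_le_sum_prod_of_pos (n : ℕ) (μ : Fin n → Bool × Bool → ℝ)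
    (hnn : ∀ i p, 0 ≤ μ i p)
    (hmargx : ∀ i b, μ i (b, true) + μ i (b, false) = 1/2)
    (hmargy : ∀ i b, μ i (true, b) + μ i (false, b) = 1/2)
    (ρ : ℝ) (hρ0 : 0 ≤ ρ) (hρ1 : ρ < 1)
    (hcor : ∀ i, |∑ p : Bool × Bool, μ i p * (sgn p.1 * sgn p.2)| ≤ ρ)
    (α β : ℝ) (hα : 0 < α) (hβ : 0 < β)
    (B₁ B₂ : Finset (Fin n → Bool))
    (hB₁ : Real.exp (-α^2) ≤ (B₁.card : ℝ) / 2^n)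
    (hB₂ : Real.exp (-β^2) ≤ (B₂.card : ℝ) / 2^n) :
    Real.exp (-(α^2 + β^2 + 2*ρ*α*β)/(1 - ρ^2)) ≤
      ∑ x ∈ B₁, ∑ y ∈ B₂, ∏ i, μ i (x i, y i) := by
  have hρ2 : 0 < 1 - ρ ^ 2 := by nlinarith
  have hd1 : 0 < α + ρ * β := by positivity
  have hd2 : 0 < β + ρ * α := by positivity
  set p := (1 - ρ ^ 2) * α / (α + ρ * β) with hp
  set q := (1 - ρ ^ 2) * β / (β + ρ * α) with hq
  have hp0 : 0 < p := by positivity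
  have hq0 : 0 < q := by positivity
  have hp1 : p ≤ 1 := by
    rw [hp, div_le_one hd1]
    nlinarith [mul_nonneg (sq_nonneg ρ) hα.le, mul_nonneg hρ0 hβ.le]
  have hq1 : q ≤ 1 := by
    rw [hq, div_le_one hd2]
    nlinarith [mul_nonneg (sq_nonneg ρ) hβ.le, mul_nonneg hρ0 hα.le]
  have hpq : (1 - p) * (1 - q) = ρ ^ 2 := by
    rw [hp, hq]; field_simp; ring
  refine le_trans ?_ (rpow_mul_rpow_le_sum_prod hp0 hp1 hq0 hq1 hρ0 hpq n μ hnn hmargx hmargy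
    hcor B₁ B₂)
  calc Real.exp (-(α^2 + β^2 + 2*ρ*α*β)/(1 - ρ^2))
      = Real.exp (-α^2) ^ (1 / p) * Real.exp (-β^2) ^ (1 / q) := by
        rw [← Real.exp_mul, ← Real.exp_mul, ← Real.exp_add, hp, hq]
        congr 1
        field_simp
        ring
    _ ≤ _ := by gcongr

/-- Reverse hypercontractivity on the discrete cube: if `(x_i, y_i)` are independent
across coordinates with uniform ±1 marginals and `|E[x_i y_i]| ≤ ρ`, and
`P[x ∈ B₁] ≥ e^{-α²}`, `P[y ∈ B₂] ≥ e^{-β²}`, then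
`P[x ∈ B₁, y ∈ B₂] ≥ exp(-(α² + β² + 2ραβ)/(1-ρ²))`.  The joint distribution of the
pair `(x, y)` is the product over coordinates of the distributions `μ i` on
`Bool × Bool`. -/
theorem stmt_3 (n : ℕ) (μ : Fin n → Bool × Bool → ℝ)
    (hnn : ∀ i p, 0 ≤ μ i p)
    (hmargx : ∀ i b, μ i (b, true) + μ i (b, false) = 1/2)
    (hmargy : ∀ i b, μ i (true, b) + μ i (false, b) = 1/2)
    (ρ : ℝ) (hρ0 : 0 ≤ ρ) (hρ1 : ρ < 1)
    (hcor : ∀ i, |∑ p : Bool × Bool, μ i p * (sgn p.1 * sgn p.2)| ≤ ρ)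
    (α β : ℝ) (hα : 0 ≤ α) (hβ : 0 ≤ β)
    (B₁ B₂ : Finset (Fin n → Bool))
    (hB₁ : Real.exp (-α^2) ≤ (B₁.card : ℝ) / 2^n)
    (hB₂ : Real.exp (-β^2) ≤ (B₂.card : ℝ) / 2^n) :
    Real.exp (-(α^2 + β^2 + 2*ρ*α*β)/(1 - ρ^2)) ≤
      ∑ x ∈ B₁, ∑ y ∈ B₂, ∏ i, μ i (x i, y i) := by
  have hcont : Continuous fun δ : ℝ =>
      Real.exp (-((α + δ)^2 + (β + δ)^2 + 2*ρ*(α + δ)*(β + δ))/(1 - ρ^2)) := by fun_prop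
  have hlim := (hcont.tendsto 0).mono_left (nhdsWithin_le_nhds (s := Set.Ioi 0))
  simp only [add_zero] at hlim
  refine le_of_tendsto hlim ?_
  filter_upwards [self_mem_nhdsWithin] with δ (hδ : 0 < δ)
  refine exp_neg_div_le_sum_prod_of_pos n μ hnn hmargx hmargy ρ hρ0 hρ1 hcor (α + δ) (β + δ)
    (by linarith) (by linarith) B₁ B₂ (le_trans ?_ hB₁) (le_trans ?_ hB₂)
  all_goals
    gcongr
    linarith
end

section
/- (Quantitative Arrow, inverse-polynomial regime, 3 alternatives) There is an absolute constant such that for all 0 < ε < 1/324 and all n: if F is an IIA constitution on 3 alternatives and n voters voting uniformly at random, and the probability of a non-transitive outcome satisfies P(F) < ε³ n^{-3}/36, then there exists a constitution G that satisfies IIA and Transitivity (i.e., G ∈ F₃(n)) with P[F(σ) ≠ G(σ)] ≤ 10ε. -/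
/-- `x^{a>b}` vector of a profile. -/
def pairVec {n : ℕ} (a b : Fin 3) (σ : Fin n → Equiv.Perm (Fin 3)) : Fin n → Bool :=
  fun i => decide (σ i a < σ i b)

/-- The outcome of the IIA constitution given by pairwise functions `fab, fbc, fca` is
non-transitive (cyclic) at profile `σ`. -/
def Paradox {n : ℕ} (fab fbc fca : (Fin n → Bool) → Bool)
    (σ : Fin n → Equiv.Perm (Fin 3)) : Prop :=
  fab (pairVec 0 1 σ) = fbc (pairVec 1 2 σ) ∧
  fbc (pairVec 1 2 σ) = fca (pairVec 2 0 σ)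

instance {n : ℕ} (fab fbc fca : (Fin n → Bool) → Bool)
    (σ : Fin n → Equiv.Perm (Fin 3)) : Decidable (Paradox fab fbc fca σ) := by
  unfold Paradox; infer_instance

section

open Finset

theorem two_point_normalized {w u : ℝ} (hw0 : 0 ≤ w) (hu0 : 0 ≤ u) (hw : w ≤ 1) (hu : u ≤ 1)
    (h : 1 ≤ w ^ 2 + u ^ 2) :
    3 / 4 ≤ w ^ 3 + 2 * u ^ 3 - 3 / 4 * (w ^ 2 + u ^ 2 - 1) * (w + 2 * u) := by
  have hw' := sub_nonneg.2 hw
  have hu' := sub_nonneg.2 hu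
  have h' := sub_nonneg.2 h
  have key : 0 ≤ (1 - u) ^ 2 * (1 + 2 * u) +
      (1 - w) * (6 * u * (w + 1) + 3 * u ^ 2 - 4 - w - w ^ 2) := by
    nlinarith [mul_nonneg hw' hu', mul_nonneg hw0 hu0, mul_nonneg hw' h', mul_nonneg hu' h',
      mul_nonneg hw0 h', mul_nonneg hu0 h', mul_nonneg hw0 hw', mul_nonneg hu0 hu',
      mul_nonneg (mul_nonneg hw0 hu0) hw', mul_nonneg (mul_nonneg hw0 hu0) hu']
  nlinarith [key]

theorem card_filter_cons {S : Type*} [Fintype S] {n : ℕ} (P : (Fin (n + 1) → S) → Prop)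
    [DecidablePred P] :
    #{σ | P σ} = ∑ s, #{σ : Fin n → S | P (Fin.cons s σ)} := by
  simp only [card_filter]
  rw [← (Fin.consEquiv fun _ => S).sum_comp, Fintype.sum_prod_type]
  rfl

theorem card_le_of_agree_off {ι S : Type*} [Fintype ι] [Fintype S] [DecidableEq ι]
    [DecidableEq S] (T : Finset ι) (A B : Finset (ι → S))
    (h : ∀ σ ∈ A, ∃ τ ∈ B, ∀ k ∉ T, σ k = τ k) :
    #A ≤ Fintype.card S ^ #T * #B := by
  have hsub : A ⊆ B.biUnion fun τ => Fintype.piFinset fun k => if k ∈ T then univ else {τ k} := by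
    intro σ hσ
    obtain ⟨τ, hτ, hk⟩ := h σ hσ
    simp only [mem_biUnion, Fintype.mem_piFinset]
    refine ⟨τ, hτ, fun k => ?_⟩
    split_ifs with hkT
    · simp
    · simpa using hk k hkT
  refine (card_le_card hsub).trans ?_
  rw [mul_comm]
  refine card_biUnion_le_card_mul _ _ _ fun τ _ => le_of_eq ?_
  simp [Fintype.card_piFinset, apply_ite Finset.card]

/-- The number of inputs at which coordinate `j` is pivotal for `f`. -/
def flipCount {n : ℕ} (f : (Fin n → Bool) → Bool) (j : Fin n) : ℕ :=
  #{v | f v ≠ f (Function.update v j (!v j))}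

theorem card_ne_piecewise_le {n : ℕ} (f : (Fin n → Bool) → Bool) (T : Finset (Fin n)) :
    #{p : (Fin n → Bool) × (Fin n → Bool) | f p.1 ≠ f (T.piecewise p.2 p.1)} ≤
      2 ^ n * ∑ j ∈ T, flipCount f j := by
  induction T using Finset.induction_on with
  | empty => simp
  | insert j T hj ih =>
    have hsub : (univ.filter fun p : (Fin n → Bool) × (Fin n → Bool) =>
        f p.1 ≠ f ((insert j T).piecewise p.2 p.1)) ⊆
        (univ.filter fun p : (Fin n → Bool) × (Fin n → Bool) =>
          f p.1 ≠ f (T.piecewise p.2 p.1)) ∪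
        (univ.filter fun p : (Fin n → Bool) × (Fin n → Bool) =>
          f (T.piecewise p.2 p.1) ≠
            f (Function.update (T.piecewise p.2 p.1) j (!(T.piecewise p.2 p.1) j))) := by
      intro p hp
      simp only [mem_union, mem_filter, mem_univ, true_and] at hp ⊢
      rw [piecewise_insert] at hp
      by_contra! hc
      rw [hc.1, hc.2] at hp
      rcases Bool.eq_or_eq_not (p.2 j) (T.piecewise p.2 p.1 j) with h | h
      · rw [h, Function.update_eq_self, ← hc.2] at hp
        exact hp rfl
      · rw [h] at hp
        exact hp rfl
    have hcard : #(univ.filter fun p : (Fin n → Bool) × (Fin n → Bool) =>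
          f (T.piecewise p.2 p.1) ≠
            f (Function.update (T.piecewise p.2 p.1) j (!(T.piecewise p.2 p.1) j))) ≤
        2 ^ n * flipCount f j := by
      have : 2 ^ n * flipCount f j = #((univ.filter fun v => f v ≠ f (Function.update v j (!v j)))
          ×ˢ (univ : Finset (Fin n → Bool))) := by
        rw [card_product, flipCount]; simp [mul_comm]
      rw [this]
      refine card_le_card_of_injOn (fun p => (T.piecewise p.2 p.1, T.piecewise p.1 p.2)) ?_ ?_
      · intro p hp
        simpa using hp
      · rintro ⟨a, b⟩ - ⟨c, d⟩ - h
        simp only [Prod.mk.injEq, funext_iff, Finset.piecewise] at h ⊢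
        constructor <;> intro k <;> have h1 := h.1 k <;> have h2 := h.2 k <;>
          split_ifs at h1 h2 <;> assumption
    rw [sum_insert hj]
    have := (card_le_card hsub).trans (card_union_le _ _)
    linarith

theorem exists_piecewise_close {n : ℕ} (f : (Fin n → Bool) → Bool) (T : Finset (Fin n))
    {δ : ℝ} (hT : ∀ j ∈ T, (flipCount f j : ℝ) ≤ δ / n * 2 ^ n) (hδ : 0 ≤ δ) :
    ∃ y, (#{v | f v ≠ f (T.piecewise y v)} : ℝ) ≤ δ * 2 ^ n := by
  by_contra! hc
  have h1 : ((∑ j ∈ T, flipCount f j : ℕ) : ℝ) ≤ δ * 2 ^ n := by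
    push_cast
    calc _ ≤ ∑ j ∈ T, δ / n * 2 ^ n := sum_le_sum hT
      _ = #T * (δ / n * 2 ^ n) := by simp
      _ ≤ n * (δ / n * 2 ^ n) := by
        gcongr
        simpa using card_le_univ T
      _ = n * (δ / n) * 2 ^ n := by ring
      _ ≤ _ := by
        gcongr
        rcases eq_or_ne (n : ℝ) 0 with h | h
        · simp [h, hδ]
        · rw [mul_div_cancel₀ _ h]
  have h2 := card_ne_piecewise_le f T
  have h3 : #{p : (Fin n → Bool) × (Fin n → Bool) | f p.1 ≠ f (T.piecewise p.2 p.1)} =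
      ∑ y, #{v | f v ≠ f (T.piecewise y v)} := by
    simp only [card_filter]
    rw [Fintype.sum_prod_type, sum_comm]
  have h4 : ∑ y : Fin n → Bool, δ * 2 ^ n <
      ∑ y : Fin n → Bool, (#{v | f v ≠ f (T.piecewise y v)} : ℝ) :=
    sum_lt_sum_of_nonempty univ_nonempty fun y _ => hc y
  rw [h3] at h2
  have h5 : (∑ y : Fin n → Bool, (#{v | f v ≠ f (T.piecewise y v)} : ℝ)) ≤
      2 ^ n * ((∑ j ∈ T, flipCount f j : ℕ) : ℝ) := by exact_mod_cast h2
  simp only [sum_const, card_univ, Fintype.card_pi, Fintype.card_bool, prod_const,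
    Fintype.card_fin, nsmul_eq_mul] at h4
  have h6 : (2:ℝ) ^ n * ((∑ j ∈ T, flipCount f j : ℕ) : ℝ) ≤ 2 ^ n * (δ * 2 ^ n) := by gcongr
  push_cast at *
  linarith

theorem two_point {a b c d : ℝ} (ha : 0 ≤ a) (hb : 0 ≤ b) (hc : 0 ≤ c) (hd : 0 ≤ d) :
    3 / 4 * (√(a ^ 2 + b ^ 2) * √(c ^ 2 + d ^ 2)) ^ 3 ≤
      (a * c) ^ 3 + (b * d) ^ 3 + 2 * (a * d) ^ 3 + 2 * (b * c) ^ 3 := by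
  have hR2 : (√(a ^ 2 + b ^ 2) * √(c ^ 2 + d ^ 2)) ^ 2 = (a ^ 2 + b ^ 2) * (c ^ 2 + d ^ 2) := by
    rw [mul_pow, Real.sq_sqrt (by positivity), Real.sq_sqrt (by positivity)]
  have hR0 : 0 ≤ √(a ^ 2 + b ^ 2) * √(c ^ 2 + d ^ 2) := by positivity
  generalize √(a ^ 2 + b ^ 2) * √(c ^ 2 + d ^ 2) = R at hR2 hR0
  rcases hR0.eq_or_lt with rfl | hR
  · rw [zero_pow three_ne_zero, mul_zero]
    positivity
  have hac := mul_nonneg ha hc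
  have hbd := mul_nonneg hb hd
  have had := mul_nonneg ha hd
  have hbc := mul_nonneg hb hc
  have h := two_point_normalized (w := (a * c + b * d) / R) (u := (a * d + b * c) / R)
    (by positivity) (by positivity)
    ((div_le_one hR).2 (abs_le_of_sq_le_sq' (by nlinarith [sq_nonneg (a * d - b * c)]) hR0).2)
    ((div_le_one hR).2 (abs_le_of_sq_le_sq' (by nlinarith [sq_nonneg (a * c - b * d)]) hR0).2)
    (by
      rw [div_pow, div_pow, ← add_div, le_div_iff₀ (by positivity)]
      nlinarith [mul_nonneg hac hbd])
  have h' := mul_le_mul_of_nonneg_right h (pow_nonneg hR0 3)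
  have e : (((a * c + b * d) / R) ^ 3 + 2 * ((a * d + b * c) / R) ^ 3 -
      3 / 4 * (((a * c + b * d) / R) ^ 2 + ((a * d + b * c) / R) ^ 2 - 1) *
        ((a * c + b * d) / R + 2 * ((a * d + b * c) / R))) * R ^ 3 =
      (a * c + b * d) ^ 3 + 2 * (a * d + b * c) ^ 3 -
      3 / 4 * ((a * c + b * d) ^ 2 + (a * d + b * c) ^ 2 - R ^ 2) *
        ((a * c + b * d) + 2 * (a * d + b * c)) := by
    field_simp
  rw [e, hR2] at h'
  refine h'.trans (le_of_eq ?_)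
  ring

/-- The maps `x`, `y`, `z` jointly identify `S` with the not-all-equal Boolean triples. -/
def IsNotAllEqual {S : Type*} [Fintype S] (x y z : S → Bool) : Prop :=
  ∀ a b c, #{s | x s = a ∧ y s = b ∧ z s = c} = if a = b ∧ b = c then 0 else 1

/-- `(f, g, h)` differs on at most a `δ` fraction of the profiles from some triple of pairwise
functions that never produces a cyclic outcome. -/
def NearTransitive {S : Type*} (x y z : S → Bool) {n : ℕ} (f g h : (Fin n → Bool) → Bool)
    (δ : ℝ) : Prop :=
  ∃ f' g' h' : (Fin n → Bool) → Bool,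
    (∀ σ : Fin n → S, ¬ (f' (fun k => x (σ k)) = g' (fun k => y (σ k)) ∧
      g' (fun k => y (σ k)) = h' (fun k => z (σ k)))) ∧
    (#{v | f v ≠ f' v} + #{v | g v ≠ g' v} + #{v | h v ≠ h' v} : ℝ) ≤ δ * 2 ^ n

theorem NearTransitive.rotate {S : Type*} {x y z : S → Bool} {n : ℕ}
    {f g h : (Fin n → Bool) → Bool} {δ : ℝ}
    (H : NearTransitive y z x g h f δ) : NearTransitive x y z f g h δ := by
  obtain ⟨g', h', f', h1, h2⟩ := H
  refine ⟨f', g', h', fun σ hσ => h1 σ ⟨hσ.2, (hσ.1.trans hσ.2).symm⟩, ?_⟩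
  linarith

namespace IsNotAllEqual

variable {S : Type*} [Fintype S] {x y z : S → Bool}

theorem rotate (H : IsNotAllEqual x y z) : IsNotAllEqual y z x := by
  intro a b c
  have : ∀ s, (y s = a ∧ z s = b ∧ x s = c) ↔ (x s = c ∧ y s = a ∧ z s = b) := by tauto
  simp only [this, H c a b]
  clear this
  revert a b c
  decide

theorem exists_eq (H : IsNotAllEqual x y z) {a b c : Bool} (h : ¬ (a = b ∧ b = c)) :
    ∃ s, x s = a ∧ y s = b ∧ z s = c := by
  have h1 := H a b c
  rw [if_neg h] at h1
  obtain ⟨s, hs⟩ := card_pos.1 (h1 ▸ one_pos)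
  exact ⟨s, by simpa using hs⟩

theorem sum_eq (H : IsNotAllEqual x y z) {M : Type*} [AddCommMonoid M]
    (φ : Bool → Bool → M) :
    ∑ s, φ (x s) (y s) = φ true true + φ false false + 2 • φ true false + 2 • φ false true := by
  have h : ∑ s, φ (x s) (y s) =
      ∑ t : Bool × Bool × Bool, #{s | (x s, y s, z s) = t} • φ t.1 t.2.1 := by
    rw [← sum_fiberwise univ (fun s => (x s, y s, z s))]
    refine sum_congr rfl fun t _ => ?_
    rw [← sum_const]
    refine sum_congr rfl fun s hs => ?_
    rw [← (mem_filter.1 hs).2]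
  have h' (t : Bool × Bool × Bool) : #{s | (x s, y s, z s) = t} =
      if t.1 = t.2.1 ∧ t.2.1 = t.2.2 then 0 else 1 := by
    rw [← H]
    congr 1
    ext s
    simp [Prod.ext_iff]
  rw [h]
  simp only [h', Fintype.sum_prod_type, Fintype.sum_bool]
  simp [two_nsmul]
  abel

theorem card_filter_fst (H : IsNotAllEqual x y z) (a : Bool) : #{s | x s = a} = 3 := by
  rw [card_filter, H.sum_eq fun p _ => if p = a then 1 else 0]
  cases a <;> simp

theorem card_eq (H : IsNotAllEqual x y z) : Fintype.card S = 6 := by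
  rw [← card_univ, card_eq_sum_ones, H.sum_eq fun _ _ => 1]
  rfl

theorem card_comp (H : IsNotAllEqual x y z) [DecidableEq S] {n : ℕ} (P : (Fin n → Bool) → Prop)
    [DecidablePred P] :
    #{σ : Fin n → S | P fun i => x (σ i)} = 3 ^ n * #{v | P v} := by
  rw [card_eq_sum_card_fiberwise (t := ({v | P v} : Finset (Fin n → Bool)))
    (f := fun σ i => x (σ i)) (fun σ hσ => by simpa using hσ), mul_comm, ← smul_eq_mul,
    ← sum_const]
  refine sum_congr rfl fun v hv => ?_
  have : ({σ ∈ ({σ : Fin n → S | P fun i => x (σ i)} : Finset _) | (fun i => x (σ i)) = v}) =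
      Fintype.piFinset fun i => ({s | x s = v i} : Finset S) := by
    ext σ
    simp only [mem_filter, mem_univ, true_and, Fintype.mem_piFinset,
      ← funext_iff (f := fun i => x (σ i))]
    refine ⟨And.right, fun h => ⟨?_, h⟩⟩
    rw [h]
    simpa using hv
  rw [this, Fintype.card_piFinset]
  simp [H.card_filter_fst]

/-- Reverse hypercontractivity for indicators: for `(x, y)` of correlation `-1/3`, the event
`x ∈ A ∧ y ∈ B` has probability at least `(μ A * μ B) ^ (3 / 2)`. -/
theorem reverse_hypercontractive (H : IsNotAllEqual x y z) {n : ℕ}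
    (A B : (Fin n → Bool) → Bool) :
    (√(#{v | A v} : ℝ) * √(#{v | B v} : ℝ)) ^ 3 * 6 ^ n ≤
      #{σ : Fin n → S | A (fun i => x (σ i)) ∧ B (fun i => y (σ i))} * 8 ^ n := by
  induction n with
  | zero =>
    have hA (v) : A v = A default := congrArg A (Subsingleton.elim _ _)
    have hB (v) : B v = B default := congrArg B (Subsingleton.elim _ _)
    simp only [hA, hB]
    rcases A default <;> rcases B default <;> simp
  | succ n ih =>
    have hc (s : S) (u : S → Bool) (σ : Fin n → S) :
        (fun i => u ((Fin.cons s σ : Fin (n + 1) → S) i)) = Fin.cons (u s) fun i => u (σ i) := by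
      funext i
      refine Fin.cases ?_ (fun _ => ?_) i <;> simp
    have hN := card_filter_cons fun σ : Fin (n + 1) → S =>
      A (fun i => x (σ i)) ∧ B (fun i => y (σ i))
    simp only [hc] at hN
    rw [H.sum_eq fun p q => #{σ : Fin n → S | A (Fin.cons p fun i => x (σ i)) ∧
      B (Fin.cons q fun i => y (σ i))}] at hN
    rw [card_filter_cons fun v => A v = true, card_filter_cons fun v => B v = true, hN,
      Fintype.sum_bool, Fintype.sum_bool]
    have h2 := fun p q => ih (fun v => A (Fin.cons p v)) (fun v => B (Fin.cons q v))
    have tp := two_point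
      (Real.sqrt_nonneg (#{v : Fin n → Bool | A (Fin.cons true v)}))
      (Real.sqrt_nonneg (#{v : Fin n → Bool | A (Fin.cons false v)}))
      (Real.sqrt_nonneg (#{v : Fin n → Bool | B (Fin.cons true v)}))
      (Real.sqrt_nonneg (#{v : Fin n → Bool | B (Fin.cons false v)}))
    simp only [Real.sq_sqrt (Nat.cast_nonneg _)] at tp
    have tp' := mul_le_mul_of_nonneg_right tp (by positivity : (0:ℝ) ≤ 6 ^ n)
    have := h2 true true
    have := h2 true false
    have := h2 false true
    have := h2 false false
    push_cast
    simp only [pow_succ _ n, nsmul_eq_mul] at *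
    push_cast
    linarith


theorem pivotal_pair_le (H : IsNotAllEqual x y z) [DecidableEq S] {n : ℕ}
    (f g h : (Fin n → Bool) → Bool) {i j : Fin n} (hij : i ≠ j) :
    #{σ : Fin n → S |
      f (fun k => x (σ k)) ≠ f (Function.update (fun k => x (σ k)) i (!x (σ i))) ∧
      g (fun k => y (σ k)) ≠ g (Function.update (fun k => y (σ k)) j (!y (σ j)))} ≤
    36 * #{σ : Fin n → S | f (fun k => x (σ k)) = g (fun k => y (σ k)) ∧
      g (fun k => y (σ k)) = h (fun k => z (σ k))} := by
  have h36 : Fintype.card S ^ #({i, j} : Finset (Fin n)) = 36 := by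
    rw [H.card_eq, card_pair hij]
    rfl
  rw [← h36]
  refine card_le_of_agree_off _ _ _ fun σ hσ => ?_
  simp only [mem_filter, mem_univ, true_and] at hσ
  have pivot (F : (Fin n → Bool) → Bool) (v : Fin n → Bool) (k : Fin n)
      (hF : F v ≠ F (Function.update v k (!v k))) (t : Bool) :
      ∃ b, F (Function.update v k b) = t := by
    by_cases ht : F v = t
    · exact ⟨v k, by rw [Function.update_eq_self, ht]⟩
    · refine ⟨!v k, ?_⟩
      revert hF ht
      generalize F v = p
      generalize F (Function.update v k (!v k)) = q
      revert p q t
      decide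
  set c := Function.update (Function.update (fun k => z (σ k)) i (!y (σ i))) j (!x (σ j)) with hc
  obtain ⟨a, ha⟩ := pivot f _ i hσ.1 (h c)
  obtain ⟨b, hb⟩ := pivot g _ j hσ.2 (h c)
  obtain ⟨s, hs1, hs2, hs3⟩ := H.exists_eq (a := a) (b := y (σ i)) (c := !y (σ i)) (by simp)
  obtain ⟨t, ht1, ht2, ht3⟩ := H.exists_eq (a := x (σ j)) (b := b) (c := !x (σ j))
    (by cases b <;> cases x (σ j) <;> simp)
  have key (u : S → Bool) : (fun k => u (Function.update (Function.update σ i s) j t k)) =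
      Function.update (Function.update (fun k => u (σ k)) i (u s)) j (u t) := by
    funext k
    simp only [Function.update_apply]
    split_ifs <;> rfl
  refine ⟨Function.update (Function.update σ i s) j t, ?_, ?_⟩
  · simp only [mem_filter, mem_univ, true_and, key]
    have e1 : Function.update (Function.update (fun k => x (σ k)) i (x s)) j (x t) =
        Function.update (fun k => x (σ k)) i a := by
      rw [hs1, ht1, Function.update_eq_iff]
      simp [Function.update_of_ne hij.symm]
    have e2 : Function.update (Function.update (fun k => y (σ k)) i (y s)) j (y t) =
        Function.update (fun k => y (σ k)) j b := by
      rw [hs2, ht2, Function.update_eq_self i (fun k => y (σ k))]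
    rw [e1, e2, hs3, ht3, ha, hb, ← hc]
    simp
  · intro k hk
    simp only [mem_insert, mem_singleton, not_or] at hk
    rw [Function.update_of_ne hk.2, Function.update_of_ne hk.1]

theorem le_card_cyclic_of_pivotal (H : IsNotAllEqual x y z) [DecidableEq S] {n : ℕ}
    (f g h : (Fin n → Bool) → Bool) {i j : Fin n} (hij : i ≠ j) {δ : ℝ} (hδ : 0 ≤ δ)
    (hi : δ * 2 ^ n ≤ flipCount f i) (hj : δ * 2 ^ n ≤ flipCount g j) :
    δ ^ 3 / 36 * 6 ^ n ≤ #{σ : Fin n → S | f (fun k => x (σ k)) = g (fun k => y (σ k)) ∧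
      g (fun k => y (σ k)) = h (fun k => z (σ k))} := by
  have h1 := H.reverse_hypercontractive
    (fun v => decide (f v ≠ f (Function.update v i (!v i))))
    (fun v => decide (g v ≠ g (Function.update v j (!v j))))
  have h2 := H.pivotal_pair_le f g h hij
  simp only [decide_eq_true_eq] at h1
  have h3 : δ * 2 ^ n ≤ √(flipCount f i : ℝ) * √(flipCount g j : ℝ) := by
    rw [← Real.sqrt_mul (by positivity)]
    refine Real.le_sqrt_of_sq_le ?_
    rw [sq]
    gcongr
  have h4 : (δ * 2 ^ n) ^ 3 * 6 ^ n ≤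
      (√(flipCount f i : ℝ) * √(flipCount g j : ℝ)) ^ 3 * 6 ^ n := by
    gcongr
  have h5 := h4.trans h1
  rw [mul_pow, ← pow_mul, mul_comm n 3, pow_mul, mul_right_comm] at h5
  norm_num only at h5
  have h6 := le_of_mul_le_mul_right h5 (by positivity)
  have h7 : ((#{σ : Fin n → S |
      f (fun k => x (σ k)) ≠ f (Function.update (fun k => x (σ k)) i (!x (σ i))) ∧
      g (fun k => y (σ k)) ≠ g (Function.update (fun k => y (σ k)) j (!y (σ j)))} : ℕ) : ℝ) ≤
      36 * #{σ : Fin n → S | f (fun k => x (σ k)) = g (fun k => y (σ k)) ∧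
      g (fun k => y (σ k)) = h (fun k => z (σ k))} := by exact_mod_cast h2
  linarith

theorem card_ne_or_le (H : IsNotAllEqual x y z) [DecidableEq S] {n : ℕ}
    (f g h f' g' h' : (Fin n → Bool) → Bool) :
    #{σ : Fin n → S | ¬ (f (fun k => x (σ k)) = f' (fun k => x (σ k)) ∧
      g (fun k => y (σ k)) = g' (fun k => y (σ k)) ∧
      h (fun k => z (σ k)) = h' (fun k => z (σ k)))} ≤
    3 ^ n * (#{v | f v ≠ f' v} + #{v | g v ≠ g' v} + #{v | h v ≠ h' v}) := by
  rw [mul_add, mul_add, ← H.card_comp fun v => f v ≠ f' v,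
    ← H.rotate.card_comp fun v => g v ≠ g' v, ← H.rotate.rotate.card_comp fun v => h v ≠ h' v]
  refine (card_le_card ?_).trans ((card_union_le _ _).trans
    (Nat.add_le_add_right (card_union_le _ _) _))
  intro σ
  simp only [mem_union, mem_filter, mem_univ, true_and]
  tauto

theorem card_cyclic_le (H : IsNotAllEqual x y z) [DecidableEq S] {n : ℕ}
    (f g h f' g' h' : (Fin n → Bool) → Bool) :
    #{σ : Fin n → S | f' (fun k => x (σ k)) = g' (fun k => y (σ k)) ∧
      g' (fun k => y (σ k)) = h' (fun k => z (σ k))} ≤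
    #{σ : Fin n → S | f (fun k => x (σ k)) = g (fun k => y (σ k)) ∧
      g (fun k => y (σ k)) = h (fun k => z (σ k))} +
    3 ^ n * (#{v | f v ≠ f' v} + #{v | g v ≠ g' v} + #{v | h v ≠ h' v}) := by
  refine (card_le_card ?_).trans ((card_union_le _ _).trans
    (Nat.add_le_add_left (H.card_ne_or_le f g h f' g' h') _))
  intro σ
  simp only [mem_union, mem_filter, mem_univ, true_and]
  grind

theorem nearTransitive_of_two_const (H : IsNotAllEqual x y z) [DecidableEq S] {n : ℕ}
    {f g h : (Fin n → Bool) → Bool} {ε : ℝ} (hε : 0 ≤ ε) {b c : Bool}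
    (hg : (#{v | g v ≠ b} : ℝ) ≤ ε * 2 ^ n) (hh : (#{v | h v ≠ c} : ℝ) ≤ ε * 2 ^ n)
    (hP : (#{σ : Fin n → S | f (fun k => x (σ k)) = g (fun k => y (σ k)) ∧
      g (fun k => y (σ k)) = h (fun k => z (σ k))} : ℝ) ≤ ε * 6 ^ n) :
    NearTransitive x y z f g h (10 * ε) := by
  have hpos : 0 ≤ ε * 2 ^ n := by positivity
  by_cases hbc : b = c
  · subst hbc
    refine ⟨fun _ => !b, fun _ => b, fun _ => b, by simp, ?_⟩
    have h1 := H.card_cyclic_le f g h f (fun _ => b) (fun _ => b)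
    simp only [and_true] at h1
    rw [H.card_comp fun v => f v = b] at h1
    have h2 : (3 ^ n * #{v | f v = b} : ℝ) ≤
        #{σ : Fin n → S | f (fun k => x (σ k)) = g (fun k => y (σ k)) ∧
          g (fun k => y (σ k)) = h (fun k => z (σ k))} +
        3 ^ n * (0 + #{v | g v ≠ b} + #{v | h v ≠ b}) := by
      have h0 : #{v | f v ≠ f v} = 0 := by simp
      rw [h0] at h1
      exact_mod_cast h1
    have h3 : (3 ^ n * #{v | f v = b} : ℝ) ≤ 3 ^ n * (3 * (ε * 2 ^ n)) := by
      have : (6 : ℝ) ^ n = 3 ^ n * 2 ^ n := by rw [← mul_pow]; norm_num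
      rw [this] at hP
      have : (3 : ℝ) ^ n * (0 + #{v | g v ≠ b} + #{v | h v ≠ b}) ≤
        3 ^ n * (0 + ε * 2 ^ n + ε * 2 ^ n) := by gcongr
      linarith
    have h4 := le_of_mul_le_mul_left h3 (by positivity)
    have h5 : ∀ v, f v ≠ !b ↔ f v = b := by simp
    simp only [h5]
    linarith
  · refine ⟨f, fun _ => b, fun _ => c, fun _ hσ => hbc hσ.2, ?_⟩
    have h0 : #{v | f v ≠ f v} = 0 := by simp
    rw [h0, Nat.cast_zero]
    linarith

theorem nearTransitive_of_dictator (H : IsNotAllEqual x y z) [DecidableEq S] {n : ℕ}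
    {f g h : (Fin n → Bool) → Bool} {ε : ℝ} (hε : 0 ≤ ε) (hε' : ε < 1 / 324) (i : Fin n)
    {a b c : Bool → Bool} (hf : (#{v | f v ≠ a (v i)} : ℝ) ≤ ε * 2 ^ n)
    (hg : (#{v | g v ≠ b (v i)} : ℝ) ≤ ε * 2 ^ n) (hh : (#{v | h v ≠ c (v i)} : ℝ) ≤ ε * 2 ^ n)
    (hP : (#{σ : Fin n → S | f (fun k => x (σ k)) = g (fun k => y (σ k)) ∧
      g (fun k => y (σ k)) = h (fun k => z (σ k))} : ℝ) ≤ ε * 6 ^ n) :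
    NearTransitive x y z f g h (10 * ε) := by
  have hpos : 0 ≤ ε * 2 ^ n := by positivity
  refine ⟨fun v => a (v i), fun v => b (v i), fun v => c (v i), fun σ hσ => ?_, by linarith⟩
  have h1 := H.card_cyclic_le f g h (fun v => a (v i)) (fun v => b (v i)) (fun v => c (v i))
  have h2 := card_le_of_agree_off {i} (univ : Finset (Fin n → S))
    {σ | a (x (σ i)) = b (y (σ i)) ∧ b (y (σ i)) = c (z (σ i))} fun τ _ =>
      ⟨Function.update τ i (σ i), by simpa using hσ, fun k hk => by
        rw [Function.update_of_ne (by simpa using hk)]⟩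
  rw [H.card_eq, card_univ, Fintype.card_fun, H.card_eq, card_singleton, Fintype.card_fin] at h2
  have h3 : (6 : ℝ) ^ n ≤ 6 * (#{σ : Fin n → S | f (fun k => x (σ k)) = g (fun k => y (σ k)) ∧
      g (fun k => y (σ k)) = h (fun k => z (σ k))} +
      3 ^ n * (#{v | f v ≠ a (v i)} + #{v | g v ≠ b (v i)} + #{v | h v ≠ c (v i)})) := by
    exact_mod_cast h2.trans (Nat.mul_le_mul_left 6 h1)
  have h4 : (3 : ℝ) ^ n * (#{v | f v ≠ a (v i)} + #{v | g v ≠ b (v i)} + #{v | h v ≠ c (v i)}) ≤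
      3 ^ n * (ε * 2 ^ n + ε * 2 ^ n + ε * 2 ^ n) := by gcongr
  have h5 : (6 : ℝ) ^ n = 3 ^ n * 2 ^ n := by rw [← mul_pow]; norm_num
  have h6 : (0 : ℝ) < 6 ^ n := by positivity
  have h7 : ε * 6 ^ n ≤ 1 / 324 * 6 ^ n := by gcongr
  have h8 : (3 : ℝ) ^ n * (ε * 2 ^ n + ε * 2 ^ n + ε * 2 ^ n) = 3 * (ε * 6 ^ n) := by
    rw [h5]; ring
  linarith

theorem nearTransitive_of_card_cyclic_lt (H : IsNotAllEqual x y z) [DecidableEq S] {n : ℕ}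
    {f g h : (Fin n → Bool) → Bool} {ε : ℝ} (hε : 0 < ε) (hε' : ε < 1 / 324) (hn : 0 < n)
    (hP : (#{σ : Fin n → S | f (fun k => x (σ k)) = g (fun k => y (σ k)) ∧
      g (fun k => y (σ k)) = h (fun k => z (σ k))} : ℝ) < (ε / n) ^ 3 / 36 * 6 ^ n) :
    NearTransitive x y z f g h (10 * ε) := by
  have rot (x y z : S → Bool) (f g h : (Fin n → Bool) → Bool) :
      #{σ : Fin n → S | g (fun k => y (σ k)) = h (fun k => z (σ k)) ∧
        h (fun k => z (σ k)) = f (fun k => x (σ k))} =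
      #{σ : Fin n → S | f (fun k => x (σ k)) = g (fun k => y (σ k)) ∧
        g (fun k => y (σ k)) = h (fun k => z (σ k))} := by
    congr 1
    ext σ
    simp only [mem_filter, mem_univ, true_and]
    grind
  have hn' : (1 : ℝ) ≤ n := by exact_mod_cast hn
  have hδ : 0 ≤ ε / n := by positivity
  have hP1 : (#{σ : Fin n → S | f (fun k => x (σ k)) = g (fun k => y (σ k)) ∧
      g (fun k => y (σ k)) = h (fun k => z (σ k))} : ℝ) ≤ ε * 6 ^ n := by
    refine hP.le.trans ?_
    gcongr
    have h1 : ε / n ≤ ε := div_le_self hε.le hn'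
    have h2 : (ε / n) ^ 3 ≤ ε ^ 3 := by gcongr
    have h3 : ε ^ 3 ≤ ε := pow_le_of_le_one hε.le (by linarith) three_ne_zero
    linarith
  let infl (F : (Fin n → Bool) → Bool) (j : Fin n) : Prop := ε / n * 2 ^ n < flipCount F j
  have unique_fg : ∀ i j, infl f i → infl g j → i = j := by
    intro i j hi hj
    by_contra hij
    exact hP.not_ge (H.le_card_cyclic_of_pivotal f g h hij hδ hi.le hj.le)
  have unique_gh : ∀ i j, infl g i → infl h j → i = j := by
    intro i j hi hj
    by_contra hij
    have := H.rotate.le_card_cyclic_of_pivotal g h f hij hδ hi.le hj.le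
    rw [rot] at this
    exact hP.not_ge this
  have unique_hf : ∀ i j, infl h i → infl f j → i = j := by
    intro i j hi hj
    by_contra hij
    have := H.rotate.rotate.le_card_cyclic_of_pivotal h f g hij hδ hi.le hj.le
    rw [rot, rot] at this
    exact hP.not_ge this
  have const (F : (Fin n → Bool) → Bool) (hF : ¬ ∃ j, infl F j) :
      ∃ b, (#{v | F v ≠ b} : ℝ) ≤ ε * 2 ^ n := by
    obtain ⟨w, hw⟩ := exists_piecewise_close F univ
      (fun j _ => not_lt.1 fun hj => hF ⟨j, hj⟩) hε.le
    exact ⟨F w, by simpa using hw⟩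
  have junta (F : (Fin n → Bool) → Bool) (i : Fin n) (hF : ∀ j, infl F j → j = i) :
      ∃ a : Bool → Bool, (#{v | F v ≠ a (v i)} : ℝ) ≤ ε * 2 ^ n := by
    obtain ⟨w, hw⟩ := exists_piecewise_close F (univ.erase i)
      (fun j hj => not_lt.1 fun hj' => (mem_erase.1 hj).1 (hF j hj')) hε.le
    refine ⟨fun b => F (Function.update w i b), ?_⟩
    convert hw using 6 with v
    funext k
    by_cases hk : k = i
    · subst hk
      simp
    · simp [Finset.piecewise, hk]
  have dictator (i : Fin n) (hf : ∀ j, infl f j → j = i) (hg : ∀ j, infl g j → j = i)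
      (hh : ∀ j, infl h j → j = i) : NearTransitive x y z f g h (10 * ε) := by
    obtain ⟨a, ha⟩ := junta f i hf
    obtain ⟨b, hb⟩ := junta g i hg
    obtain ⟨c, hc⟩ := junta h i hh
    exact H.nearTransitive_of_dictator hε.le hε' i ha hb hc hP1
  by_cases hf : ∃ i, infl f i
  · obtain ⟨i, hi⟩ := hf
    by_cases hg : ∃ j, infl g j
    · exact dictator i (by grind) (by grind) (by grind)
    by_cases hh : ∃ j, infl h j
    · exact dictator i (by grind) (by grind) (by grind)
    obtain ⟨b, hb⟩ := const g hg
    obtain ⟨c, hc⟩ := const h hh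
    exact H.nearTransitive_of_two_const hε.le hb hc hP1
  · obtain ⟨a, ha⟩ := const f hf
    by_cases hg : ∃ j, infl g j
    · obtain ⟨i, hi⟩ := hg
      by_cases hh : ∃ j, infl h j
      · exact dictator i (by grind) (by grind) (by grind)
      obtain ⟨c, hc⟩ := const h hh
      rw [← rot] at hP1
      exact (H.rotate.nearTransitive_of_two_const hε.le hc ha hP1).rotate
    · obtain ⟨b, hb⟩ := const g hg
      rw [← rot, ← rot] at hP1
      exact (H.rotate.rotate.nearTransitive_of_two_const hε.le ha hb hP1).rotate.rotate

end IsNotAllEqual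

theorem isNotAllEqual_perm : IsNotAllEqual (fun s : Equiv.Perm (Fin 3) => decide (s 0 < s 1))
    (fun s => decide (s 1 < s 2)) (fun s => decide (s 2 < s 0)) := by
  unfold IsNotAllEqual
  decide

end

/-- Quantitative Arrow theorem in the inverse-polynomial regime, 3 alternatives:
if an IIA constitution `F = (fab, fbc, fca)` on `n` uniform voters has paradox
probability `< ε³ n⁻³ / 36` (with `0 < ε < 1/324`), then there is an IIA constitution
`G = (gab, gbc, gca)` which is transitive on every profile and agrees with `F` except
with probability at most `10ε`. -/
theorem stmt_19 (n : ℕ) (ε : ℝ) (hε0 : 0 < ε) (hε1 : ε < 1/324)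
    (fab fbc fca : (Fin n → Bool) → Bool)
    (hP : ((Finset.univ.filter fun σ : Fin n → Equiv.Perm (Fin 3) =>
        Paradox fab fbc fca σ).card : ℝ) / 6^n < ε^3 * (n:ℝ)⁻¹^3 / 36) :
    ∃ gab gbc gca : (Fin n → Bool) → Bool,
      (∀ σ : Fin n → Equiv.Perm (Fin 3), ¬ Paradox gab gbc gca σ) ∧
      ((Finset.univ.filter fun σ : Fin n → Equiv.Perm (Fin 3) =>
          ¬ (fab (pairVec 0 1 σ) = gab (pairVec 0 1 σ) ∧
             fbc (pairVec 1 2 σ) = gbc (pairVec 1 2 σ) ∧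
             fca (pairVec 2 0 σ) = gca (pairVec 2 0 σ))).card : ℝ) / 6^n ≤ 10 * ε := by
  have hn : 0 < n := by
    rcases Nat.eq_zero_or_pos n with rfl | hn
    · have : (0 : ℝ) ≤ ((Finset.univ.filter fun σ : Fin 0 → Equiv.Perm (Fin 3) =>
        Paradox fab fbc fca σ).card : ℝ) / 6 ^ 0 := by positivity
      norm_num at hP this
      linarith
    · exact hn
  have h6 : (0 : ℝ) < 6 ^ n := by positivity
  rw [div_lt_iff₀ h6, ← mul_pow, ← div_eq_mul_inv] at hP
  obtain ⟨gab, gbc, gca, htrans, hclose⟩ :=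
    isNotAllEqual_perm.nearTransitive_of_card_cyclic_lt hε0 hε1 hn (f := fab) (g := fbc) (h := fca)
      (lt_of_eq_of_lt (by congr) hP)
  refine ⟨gab, gbc, gca, htrans, ?_⟩
  rw [div_le_iff₀ h6]
  have hle := isNotAllEqual_perm.card_ne_or_le fab fbc fca gab gbc gca
  calc _ ≤ ((3 ^ n * ((Finset.univ.filter fun v => fab v ≠ gab v).card +
        (Finset.univ.filter fun v => fbc v ≠ gbc v).card +
        (Finset.univ.filter fun v => fca v ≠ gca v).card) : ℕ) : ℝ) := by exact_mod_cast hle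
    _ ≤ 3 ^ n * (10 * ε * 2 ^ n) := by
      push_cast
      gcongr
    _ = 10 * ε * 6 ^ n := by
      rw [mul_left_comm, ← mul_pow]
      norm_num
end
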